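/- Let N ≥ 2, let f satisfy (H1) and in addition hypothesis (H3), and let u be any bounded nonnegative solution of problem (eqbis) in the half-space Ω' with boundary datum u₀ ≢ 0. Then there exists z ≥ μ with f(z) = 0 such that for all A ∈ ℝ, the translates u(x₁+h, x₂, …, x_N) converge to the constant z as h → +∞ uniformly on [A,+∞) × ℝ^{N-1}, together with all partial derivatives up to order two. -/

import Mathlib

open Set Filter

noncomputable section

/-- Partial derivative of `u` in the `i`-th coordinate direction. -/
def pd {N : ℕ} (i : Fin N) (u : (Fin N → ℝ) → ℝ) (x : Fin N → ℝ) : ℝ :=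
  deriv (fun t => u (Function.update x i t)) (x i)

/-- Laplace operator: the sum of the pure second partial derivatives. -/
def lap {N : ℕ} (u : (Fin N → ℝ) → ℝ) (x : Fin N → ℝ) : ℝ :=
  ∑ i, pd i (pd i u) x

/-- `f` is locally Lipschitz-continuous on `[0, +∞)`. -/
def LocLipOn (f : ℝ → ℝ) : Prop :=
  ∀ b : ℝ, ∃ L : NNReal, LipschitzOnWith L f (Set.Icc 0 b)

/-- Hypothesis (H1): `f` is locally Lipschitz on `[0,∞)`, positive on `(0,μ)`, nonpositive on
`[μ,∞)`, nonincreasing on `[μ',μ]`, and either `f(0) > 0` or `f(0) = 0` with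
`liminf_{s→0⁺} f(s)/s > 0`. -/
def H1 (f : ℝ → ℝ) (μ' μ : ℝ) : Prop :=
  LocLipOn f ∧ 0 < μ' ∧ μ' < μ ∧
  (∀ s, 0 < s → s < μ → 0 < f s) ∧
  (∀ s, μ ≤ s → f s ≤ 0) ∧
  (∀ s t, μ' ≤ s → s ≤ t → t ≤ μ → f t ≤ f s) ∧
  (0 < f 0 ∨ (f 0 = 0 ∧ ∃ c > 0, ∀ᶠ s in nhdsWithin (0:ℝ) (Set.Ioi 0), c ≤ f s / s))

/-- Hypothesis (H2): `f` is locally Lipschitz and nonnegative on `[0,∞)`, and at every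
nonnegative zero `z` of `f`, `liminf_{s→z⁺} f(s)/(s-z) > 0`. -/
def H2 (f : ℝ → ℝ) : Prop :=
  LocLipOn f ∧ (∀ s, 0 ≤ s → 0 ≤ f s) ∧
  (∀ z, 0 ≤ z → f z = 0 → ∃ c > 0, ∀ᶠ s in nhdsWithin z (Set.Ioi z), c ≤ f s / (s - z))

/-- Hypothesis (H3): `liminf_{s→z⁻} f(s)/(s-z) > 0` for every zero `z > μ` of `f`. -/
def H3 (f : ℝ → ℝ) (μ : ℝ) : Prop :=
  ∀ z, μ < z → f z = 0 → ∃ c > 0, ∀ᶠ s in nhdsWithin z (Set.Iio z), c ≤ f s / (s - z)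

/-- `(V, V')` is a `C²` solution on `[0,+∞)` of `V'' + f(V) = 0` with `V(0) = 0`,
`0 < V < z` on `(0,+∞)` and `V(+∞) = z` (the one-dimensional profile `V_z`). -/
def IsProfile (f : ℝ → ℝ) (z : ℝ) (V V' : ℝ → ℝ) : Prop :=
  (∀ ξ ∈ Set.Ici (0:ℝ), HasDerivWithinAt V (V' ξ) (Set.Ici 0) ξ) ∧
  (∀ ξ ∈ Set.Ici (0:ℝ), HasDerivWithinAt V' (-(f (V ξ))) (Set.Ici 0) ξ) ∧
  V 0 = 0 ∧ (∀ ξ, 0 < ξ → 0 < V ξ ∧ V ξ < z) ∧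
  Filter.Tendsto V Filter.atTop (nhds z)

/-- The translates `x ↦ u(x + h e₁)` converge as `h → +∞`, uniformly on `K` together with all
partial derivatives up to order two, to the limits `w`, `w1 i`, `w2 i j`. -/
def C2ConvOn {N : ℕ} (i0 : Fin N) (u : (Fin N → ℝ) → ℝ) (K : Set (Fin N → ℝ))
    (w : (Fin N → ℝ) → ℝ) (w1 : Fin N → (Fin N → ℝ) → ℝ)
    (w2 : Fin N → Fin N → (Fin N → ℝ) → ℝ) : Prop :=
  TendstoUniformlyOn (fun (h : ℝ) x => u (Function.update x i0 (x i0 + h))) w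
    Filter.atTop K ∧
  (∀ i, TendstoUniformlyOn (fun (h : ℝ) x => pd i u (Function.update x i0 (x i0 + h)))
      (w1 i) Filter.atTop K) ∧
  (∀ i j, TendstoUniformlyOn
      (fun (h : ℝ) x => pd i (pd j u) (Function.update x i0 (x i0 + h)))
      (w2 i j) Filter.atTop K)

/-- `F(z) = ∫₀^z f(σ) dσ`. -/
def Ff (f : ℝ → ℝ) (z : ℝ) : ℝ := ∫ σ in (0:ℝ)..z, f σ

/-- The set `Z_f = {z₀ ≥ 0 : f(z₀) = 0 and F(z) < F(z₀) for all z ∈ [0,z₀)}`. -/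
def Zf (f : ℝ → ℝ) : Set ℝ :=
  {z | 0 ≤ z ∧ f z = 0 ∧ ∀ w, 0 ≤ w → w < z → Ff f w < Ff f z}

/-- `(V, V')` belongs to `R_f`: a bounded nonnegative `C²` solution on `[0,∞)` of
`V'' + f(V) = 0` with `V(0) = 0`. -/
def InRf (f V V' : ℝ → ℝ) : Prop :=
  (∀ ξ ∈ Set.Ici (0:ℝ), HasDerivWithinAt V (V' ξ) (Set.Ici 0) ξ) ∧
  (∀ ξ ∈ Set.Ici (0:ℝ), HasDerivWithinAt V' (-(f (V ξ))) (Set.Ici 0) ξ) ∧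
  V 0 = 0 ∧ (∀ ξ, 0 ≤ ξ → 0 ≤ V ξ) ∧ (∃ C, ∀ ξ, 0 ≤ ξ → V ξ ≤ C)

/-- `s` is differentiable near `t₀` and its derivative has derivative `a` at `t₀`. -/
def HasD2 (s : ℝ → ℝ) (a t₀ : ℝ) : Prop :=
  ∃ s' : ℝ → ℝ, (∀ᶠ t in nhds t₀, HasDerivAt s (s' t) t) ∧ HasDerivAt s' a t₀

lemma HasD2.add {s r : ℝ → ℝ} {a b t₀ : ℝ} (hs : HasD2 s a t₀) (hr : HasD2 r b t₀) :
    HasD2 (fun t => s t + r t) (a + b) t₀ := by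
  obtain ⟨s', hs1, hs2⟩ := hs
  obtain ⟨r', hr1, hr2⟩ := hr
  refine ⟨fun t => s' t + r' t, ?_, hs2.add hr2⟩
  filter_upwards [hs1, hr1] with t h1 h2 using h1.add h2

lemma HasD2.const_mul {s : ℝ → ℝ} {a t₀ : ℝ} (c : ℝ) (hs : HasD2 s a t₀) :
    HasD2 (fun t => c * s t) (c * a) t₀ := by
  obtain ⟨s', hs1, hs2⟩ := hs
  refine ⟨fun t => c * s' t, ?_, hs2.const_mul c⟩
  filter_upwards [hs1] with t h1 using h1.const_mul c

lemma hasD2_const (c t₀ : ℝ) : HasD2 (fun _ => c) 0 t₀ :=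
  ⟨fun _ => 0, Eventually.of_forall fun t => hasDerivAt_const t c, hasDerivAt_const t₀ 0⟩

lemma HasD2.comp_affine {s : ℝ → ℝ} {a e c t₀ : ℝ} (he : e * e = 1)
    (hs : HasD2 s a (e * t₀ + c)) : HasD2 (fun t => s (e * t + c)) a t₀ := by
  obtain ⟨s', hs1, hs2⟩ := hs
  have haff : ∀ t, HasDerivAt (fun t => e * t + c) e t := fun t => by
    simpa using ((hasDerivAt_id t).const_mul e).add_const c
  refine ⟨fun t => s' (e * t + c) * e, ?_, ?_⟩
  · have : Tendsto (fun t => e * t + c) (nhds t₀) (nhds (e * t₀ + c)) :=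
      (haff t₀).continuousAt
    filter_upwards [this.eventually hs1] with t ht
    exact HasDerivAt.comp t ht (haff t)
  · have := (HasDerivAt.comp t₀ hs2 (haff t₀)).mul_const e
    rwa [mul_assoc, he, mul_one] at this

lemma HasD2.nonneg {s : ℝ → ℝ} {a t₀ : ℝ} (hs : HasD2 s a t₀) (hmin : IsLocalMin s t₀) :
    0 ≤ a := by
  obtain ⟨s', hs1, hs2⟩ := hs
  by_contra! ha
  have h0 : s' t₀ = 0 := hmin.hasDerivAt_eq_zero hs1.self_of_nhds
  have hneg : ∀ᶠ t in nhdsWithin t₀ (Ioi t₀), s' t < 0 := by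
    have h := (hasDerivWithinAt_iff_tendsto_slope' (s := Ioi t₀) (by simp)).1
      (hs2.hasDerivWithinAt (s := Ioi t₀))
    filter_upwards [h.eventually_lt_const ha, self_mem_nhdsWithin] with t h1 h2
    rw [slope_def_field, h0, sub_zero] at h1
    have h3 : 0 < t - t₀ := sub_pos.2 h2
    by_contra! h4
    exact absurd h1 (not_lt.2 (div_nonneg h4 h3.le))
  have h3 : ∀ᶠ t in nhds t₀, HasDerivAt s (s' t) t ∧ s t₀ ≤ s t := hs1.and hmin
  obtain ⟨ε, hε, hball⟩ := Metric.eventually_nhds_iff.1 h3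
  obtain ⟨η, hη, hIoo⟩ := (mem_nhdsGT_iff_exists_Ioo_subset).1 hneg
  have hη' : t₀ < η := hη
  set b := min (t₀ + ε / 2) ((t₀ + η) / 2) with hb
  have hb1 : t₀ < b := lt_min (by linarith) (by linarith)
  have hb2 : b ≤ t₀ + ε / 2 := min_le_left _ _
  have hb3 : b ≤ (t₀ + η) / 2 := min_le_right _ _
  have hd : ∀ t ∈ Icc t₀ b, HasDerivAt s (s' t) t := fun t ht =>
    (hball (by rw [Real.dist_eq, abs_lt]; constructor <;> linarith [ht.1, ht.2])).1
  obtain ⟨c, hc, hc'⟩ := exists_hasDerivAt_eq_slope s s' hb1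
    (fun t ht => (hd t ht).continuousAt.continuousWithinAt)
    (fun t ht => hd t ⟨ht.1.le, ht.2.le⟩)
  have h5 : s' c < 0 := hIoo ⟨hc.1, by linarith [hc.2]⟩
  have h6 : s t₀ ≤ s b :=
    (hball (by rw [Real.dist_eq, abs_lt]; constructor <;> linarith)).2
  rw [hc'] at h5
  exact absurd h5 (not_lt.2 (div_nonneg (by linarith) (by linarith)))

/-- The second derivatives of `w` along the coordinate lines through `x` exist, with sum `L`. -/
def HasLap {N : ℕ} (w : (Fin N → ℝ) → ℝ) (x : Fin N → ℝ) (L : ℝ) : Prop :=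
  ∃ a : Fin N → ℝ,
    (∀ i, HasD2 (fun t => w (Function.update x i t)) (a i) (x i)) ∧ ∑ i, a i = L

section HasLap

variable {N : ℕ} {w v : (Fin N → ℝ) → ℝ} {x : Fin N → ℝ} {L L' : ℝ}

lemma HasLap.add (hw : HasLap w x L) (hv : HasLap v x L') :
    HasLap (fun x => w x + v x) x (L + L') := by
  obtain ⟨a, ha, rfl⟩ := hw
  obtain ⟨b, hb, rfl⟩ := hv
  exact ⟨fun i => a i + b i, fun i => (ha i).add (hb i), Finset.sum_add_distrib⟩

lemma HasLap.const_mul (c : ℝ) (hw : HasLap w x L) : HasLap (fun x => c * w x) x (c * L) := by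
  obtain ⟨a, ha, rfl⟩ := hw
  exact ⟨fun i => c * a i, fun i => (ha i).const_mul c, (Finset.mul_sum _ _ _).symm⟩

lemma hasLap_const (c : ℝ) (x : Fin N → ℝ) : HasLap (fun _ => c) x 0 :=
  ⟨fun _ => 0, fun _ => hasD2_const _ _, by simp⟩

lemma HasLap.neg (hw : HasLap w x L) : HasLap (fun x => -w x) x (-L) := by
  simpa using hw.const_mul (-1)

lemma HasLap.sub (hw : HasLap w x L) (hv : HasLap v x L') :
    HasLap (fun x => w x - v x) x (L - L') := by
  simpa [sub_eq_add_neg] using hw.add hv.neg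

lemma HasLap.comp_affine {e c : Fin N → ℝ} (he : ∀ i, e i * e i = 1)
    (hw : HasLap w (fun i => e i * x i + c i) L) :
    HasLap (fun x => w (fun i => e i * x i + c i)) x L := by
  obtain ⟨a, ha, hL⟩ := hw
  refine ⟨a, fun i => ?_, hL⟩
  convert (ha i).comp_affine (he i) using 3 with t
  ext j
  by_cases hj : j = i
  · subst hj; simp
  · simp [hj]

lemma continuous_update_right (x : Fin N → ℝ) (i : Fin N) :
    Continuous fun t : ℝ => Function.update x i t :=
  continuous_const.update i continuous_id

lemma HasLap.nonneg (hw : HasLap w x L) (hmin : IsLocalMin w x) : 0 ≤ L := by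
  obtain ⟨a, ha, rfl⟩ := hw
  refine Finset.sum_nonneg fun i _ => (ha i).nonneg ?_
  have h1 : Tendsto (fun t : ℝ => Function.update x i t) (nhds (x i)) (nhds x) := by
    have := (continuous_update_right x i).tendsto (x i)
    rwa [Function.update_eq_self] at this
  filter_upwards [h1.eventually hmin] with t ht
  simpa using ht

end HasLap

/-- Squared Euclidean distance. -/
def sqd {N : ℕ} (p x : Fin N → ℝ) : ℝ := ∑ i, (x i - p i) ^ 2

section sqd

variable {N : ℕ}

lemma sqd_self (p : Fin N → ℝ) : sqd p p = 0 := by simp [sqd]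

lemma sqd_nonneg (p x : Fin N → ℝ) : 0 ≤ sqd p x :=
  Finset.sum_nonneg fun _ _ => sq_nonneg _

lemma sq_le_sqd (p x : Fin N → ℝ) (i : Fin N) : (x i - p i) ^ 2 ≤ sqd p x :=
  Finset.single_le_sum (f := fun i => (x i - p i) ^ 2) (fun _ _ => sq_nonneg _)
    (Finset.mem_univ i)

lemma abs_sub_le_of_sqd_le {p x : Fin N → ℝ} {r : ℝ} (hr : 0 ≤ r) (h : sqd p x ≤ r ^ 2)
    (i : Fin N) : |x i - p i| ≤ r :=
  abs_le_of_sq_le_sq ((sq_le_sqd p x i).trans h) hr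

lemma continuous_sqd (p : Fin N → ℝ) : Continuous (sqd p) := by
  unfold sqd; fun_prop

lemma continuous_sqd_left (x : Fin N → ℝ) : Continuous fun p => sqd p x := by
  unfold sqd; fun_prop

lemma isCompact_sqd_le (p : Fin N → ℝ) (b : ℝ) : IsCompact {x | sqd p x ≤ b} := by
  refine (isCompact_closedBall p (|b| + 1)).of_isClosed_subset
    (isClosed_le (continuous_sqd p) continuous_const) fun x hx => ?_
  have hx' : sqd p x ≤ b := hx
  rw [Metric.mem_closedBall, dist_pi_le_iff (by positivity)]
  intro i
  rw [Real.dist_eq]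
  refine abs_sub_le_of_sqd_le (by positivity) (hx'.trans ?_) i
  nlinarith [le_abs_self b, abs_nonneg b]

lemma sqd_update (p x : Fin N → ℝ) (i : Fin N) (t : ℝ) :
    sqd p (Function.update x i t) = sqd p x - (x i - p i) ^ 2 + (t - p i) ^ 2 := by
  have h1 := Finset.add_sum_erase Finset.univ (fun j => (x j - p j) ^ 2) (Finset.mem_univ i)
  have h2 := Finset.add_sum_erase Finset.univ
    (fun j => (Function.update x i t j - p j) ^ 2) (Finset.mem_univ i)
  have h3 : ∑ j ∈ Finset.univ.erase i, (Function.update x i t j - p j) ^ 2 =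
      ∑ j ∈ Finset.univ.erase i, (x j - p j) ^ 2 :=
    Finset.sum_congr rfl fun j hj => by simp [Finset.ne_of_mem_erase hj]
  simp only [Function.update_self, h3] at h2
  unfold sqd
  linarith

lemma hasLap_radial {G G' G'' : ℝ → ℝ} (h1 : ∀ s, HasDerivAt G (G' s) s)
    (h2 : ∀ s, HasDerivAt G' (G'' s) s) (p x : Fin N → ℝ) :
    HasLap (fun x => G (sqd p x)) x (4 * sqd p x * G'' (sqd p x) + 2 * N * G' (sqd p x)) := by
  refine ⟨fun i => 4 * (x i - p i) ^ 2 * G'' (sqd p x) + 2 * G' (sqd p x), fun i => ?_, ?_⟩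
  · simp only [sqd_update]
    set c := sqd p x - (x i - p i) ^ 2 with hc
    have hq : ∀ t, HasDerivAt (fun t => c + (t - p i) ^ 2) (2 * (t - p i)) t := fun t => by
      simpa using (((hasDerivAt_id t).sub_const (p i)).pow 2).const_add c
    refine ⟨fun t => G' (c + (t - p i) ^ 2) * (2 * (t - p i)),
      Eventually.of_forall fun t => HasDerivAt.comp t (h1 _) (hq t), ?_⟩
    have hl : HasDerivAt (fun t => 2 * (t - p i)) 2 (x i) := by
      simpa using ((hasDerivAt_id (x i)).sub_const (p i)).const_mul 2
    have := (HasDerivAt.comp (x i) (h2 _) (hq (x i))).mul hl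
    have hcs : c + (x i - p i) ^ 2 = sqd p x := by rw [hc]; ring
    simp only [Function.comp_apply, hcs] at this
    refine HasDerivAt.congr_deriv this ?_
    ring
  · rw [Finset.sum_add_distrib, ← Finset.sum_mul, ← Finset.mul_sum, Finset.sum_const,
      Finset.card_univ, Fintype.card_fin, nsmul_eq_mul, sqd]
    ring

end sqd

section Comparison

variable {N : ℕ}

/-- A positive function `v` with `Δv ≤ -c v` wherever `v < δ`, on a ball large enough in terms
of `c`, is at least `δ` at the centre. -/
lemma le_center_of_supersolution {v : (Fin N → ℝ) → ℝ} {y : Fin N → ℝ} {c δ R : ℝ} (hR : 0 < R)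
    (hc : (8 + 4 * (N : ℝ)) ^ 2 < 32 * R ^ 2 * c) (hδ : 0 < δ)
    (hcont : ContinuousOn v {x | sqd y x ≤ R ^ 2}) (hpos : ∀ x, sqd y x ≤ R ^ 2 → 0 < v x)
    (hlap : ∀ x, sqd y x < R ^ 2 → v x < δ → ∃ L, HasLap v x L ∧ L ≤ -c * v x) :
    δ ≤ v y := by
  set φ : (Fin N → ℝ) → ℝ := fun x => (R ^ 2 - sqd y x) ^ 2 with hφ
  have hφc : Continuous φ := (continuous_const.sub (continuous_sqd y)).pow 2
  have hy : sqd y y ≤ R ^ 2 := by rw [sqd_self]; positivity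
  obtain ⟨z, hz, hmax⟩ := (isCompact_sqd_le y (R ^ 2)).exists_isMaxOn ⟨y, hy⟩
    (hφc.continuousOn.div hcont fun x hx => (hpos x hx).ne')
  have hz' : sqd y z ≤ R ^ 2 := hz
  have hvz := hpos z hz
  have hvy := hpos y hy
  have hle : ∀ x, sqd y x ≤ R ^ 2 → φ x / v x ≤ φ z / v z := fun x hx => hmax hx
  set r := φ z / v z with hr
  have hφy : φ y = R ^ 4 := by simp only [hφ, sqd_self]; ring
  have hr0 : 0 < r := lt_of_lt_of_le (by rw [hφy]; positivity) (hle y hy)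
  have hφz : φ z = r * v z := by rw [hr]; field_simp
  have hzlt : sqd y z < R ^ 2 := by
    refine lt_of_le_of_ne hz' fun h => ?_
    have : φ z = 0 := by simp [hφ, h]
    rw [hφz] at this
    exact (mul_pos hr0 hvz).ne' this
  have hδz : δ ≤ v z := by
    by_contra! hlt
    obtain ⟨L, hL, hLc⟩ := hlap z hzlt hlt
    have hφL : HasLap φ z (4 * sqd y z * 2 + 2 * N * (-2 * (R ^ 2 - sqd y z))) := by
      refine hasLap_radial (G := fun s => (R ^ 2 - s) ^ 2) (G' := fun s => -2 * (R ^ 2 - s))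
        (G'' := fun _ => 2) (fun s => ?_) (fun s => ?_) y z
      · have := ((hasDerivAt_id s).const_sub (R ^ 2)).pow 2
        refine HasDerivAt.congr_deriv this ?_
        simp
      · have := ((hasDerivAt_id s).const_sub (R ^ 2)).const_mul (-2)
        refine HasDerivAt.congr_deriv this ?_
        simp
    have hmin : IsLocalMin (fun x => r * v x - φ x) z := by
      have hnhds : ∀ᶠ x in nhds z, sqd y x < R ^ 2 :=
        (continuous_sqd y).continuousAt.eventually_lt continuousAt_const hzlt
      filter_upwards [hnhds] with x hx
      have := hle x hx.le
      rw [div_le_iff₀ (hpos x hx.le)] at this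
      show r * v z - φ z ≤ r * v x - φ x
      rw [hφz]
      linarith
    have h0 := ((hL.const_mul r).sub hφL).nonneg hmin
    have h1 : r * L ≤ -c * φ z := by
      rw [hφz]; nlinarith
    have hφz2 : φ z = (R ^ 2 - sqd y z) ^ 2 := rfl
    rw [hφz2] at h1
    set p := R ^ 2 - sqd y z with hp
    have hq : sqd y z = R ^ 2 - p := by rw [hp]; ring
    rw [hq] at h0
    have hcpos : 0 < c := by
      by_contra! hcn
      nlinarith [mul_nonneg (sq_nonneg R) (neg_nonneg.2 hcn), sq_nonneg (8 + 4 * (N : ℝ))]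
    have h2 : 0 < 8 * R ^ 2 - (8 + 4 * N) * p + c * p ^ 2 := by
      have : 0 < 4 * c * (8 * R ^ 2 - (8 + 4 * N) * p + c * p ^ 2) := by
        nlinarith [sq_nonneg (2 * c * p - (8 + 4 * N))]
      exact pos_of_mul_pos_right this (by positivity)
    nlinarith
  have h3 : r ≤ R ^ 4 / δ := by
    rw [hr]
    refine div_le_div₀ (by positivity) ?_ hδ hδz
    have h0 := sqd_nonneg y z
    calc φ z = (R ^ 2 - sqd y z) ^ 2 := rfl
      _ ≤ (R ^ 2) ^ 2 := by
        refine pow_le_pow_left₀ (by linarith) (by linarith) 2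
      _ = R ^ 4 := by ring
  have h4 := (hle y hy).trans h3
  rw [hφy] at h4
  have hR4 : 0 < R ^ 4 := by positivity
  rwa [div_le_div_iff_of_pos_left hR4 hvy hδ] at h4

/-- Quantitative strong maximum principle for nonnegative functions that are superharmonic where
they are small. -/
lemma exists_propagation_const [NeZero N] {a b' b : ℝ} (ha : 0 < a) (hb : b' < b) :
    ∃ κ > 0, ∀ (w : (Fin N → ℝ) → ℝ) (p : Fin N → ℝ) (ε : ℝ), 0 < ε →
      ContinuousOn w {x | sqd p x ≤ b} → (∀ x, sqd p x ≤ b → 0 ≤ w x) →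
      (∀ x, sqd p x ≤ a → ε ≤ w x) →
      (∀ x, sqd p x < b → w x < ε → ∃ L ≤ 0, HasLap w x L) →
      ∀ x, sqd p x ≤ b' → ε * κ ≤ w x := by
  have hN : (0 : ℝ) < N := by exact_mod_cast Nat.pos_of_ne_zero (NeZero.ne N)
  set α : ℝ := N / a with hα
  have hα0 : 0 < α := by positivity
  have hαa : α * a = N := by rw [hα]; field_simp
  set G : ℝ → ℝ := fun s => Real.exp (-α * s) - Real.exp (-α * b) with hG
  have hGanti : ∀ {s t}, s ≤ t → G t ≤ G s := fun {s t} h => by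
    have : Real.exp (-α * t) ≤ Real.exp (-α * s) := Real.exp_le_exp.2 (by nlinarith)
    simp only [hG]; linarith
  have hG1 : ∀ s, 0 ≤ s → G s ≤ 1 := fun s hs => by
    have h1 : Real.exp (-α * s) ≤ 1 := Real.exp_le_one_iff.2 (by nlinarith)
    have h2 := Real.exp_pos (-α * b)
    simp only [hG]; linarith
  have hκ : 0 < G b' := by
    have : Real.exp (-α * b) < Real.exp (-α * b') := Real.exp_lt_exp.2 (by nlinarith)
    simp only [hG]; linarith
  refine ⟨G b', hκ, fun w p ε hε hcont hnn hin hlap x hx => ?_⟩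
  have hGc : Continuous fun x => G (sqd p x) := by
    have := continuous_sqd p
    simp only [hG]; fun_prop
  have hxb : sqd p x ≤ b := hx.trans hb.le
  obtain ⟨z, hz, hmin⟩ := (isCompact_sqd_le p b).exists_isMinOn ⟨x, hxb⟩
    (hcont.sub (hGc.const_smul ε).continuousOn)
  have hz' : sqd p z ≤ b := hz
  have hle : ∀ x, sqd p x ≤ b → w z - ε * G (sqd p z) ≤ w x - ε * G (sqd p x) :=
    fun x hx => hmin hx
  have hGz := hG1 _ (sqd_nonneg p z)
  have key : 0 ≤ w z - ε * G (sqd p z) := by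
    by_contra! hneg
    have hzb : sqd p z < b := by
      refine lt_of_le_of_ne hz' fun h => ?_
      have h0 : G (sqd p z) = 0 := by simp [hG, h]
      have := hnn z hz'
      rw [h0] at hneg
      linarith
    have hza : a < sqd p z := by
      by_contra! h
      have := hin z h
      nlinarith
    obtain ⟨L, hL0, hL⟩ := hlap z hzb (by nlinarith)
    have hGL := hasLap_radial (G := G) (G' := fun s => -α * Real.exp (-α * s))
        (G'' := fun s => α ^ 2 * Real.exp (-α * s)) (fun s => by
          have := ((((hasDerivAt_id s).const_mul (-α)).exp).sub_const (Real.exp (-α * b)))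
          refine HasDerivAt.congr_deriv this ?_
          simp [mul_comm]) (fun s => by
          have := (((hasDerivAt_id s).const_mul (-α)).exp).const_mul (-α)
          refine HasDerivAt.congr_deriv this ?_
          simp; ring) p z
    have hlm : IsLocalMin (fun x => w x - ε * G (sqd p x)) z := by
      have hnhds : ∀ᶠ x in nhds z, sqd p x < b :=
        (continuous_sqd p).continuousAt.eventually_lt continuousAt_const hzb
      filter_upwards [hnhds] with x hx using hle x hx.le
    have h0 := (hL.sub (hGL.const_mul ε)).nonneg hlm
    have hexp := Real.exp_pos (-α * sqd p z)
    have h5 : 0 < 4 * sqd p z * α - 2 * N := by nlinarith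
    have h6 : 0 < α * Real.exp (-α * sqd p z) * (4 * sqd p z * α - 2 * N) := by positivity
    nlinarith
  have h1 := hle x hxb
  have h2 := hGanti hx
  nlinarith

/-- One-sided interior gradient bound for the Poisson equation. -/
lemma gradient_bound_above {w : (Fin N → ℝ) → ℝ} {y : Fin N → ℝ} {i : Fin N} {A D : ℝ}
    (hA : 0 < A) (hcont : ContinuousOn w (Metric.closedBall y 1))
    (hbd : ∀ x ∈ Metric.closedBall y 1, |w x| ≤ A)
    (hlap : ∀ x ∈ Metric.closedBall y 1, ∃ L, HasLap w x L ∧ |L| ≤ A)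
    (hD : HasDerivAt (fun t => w (Function.update y i t)) D (y i)) :
    D ≤ (2 * N + 2) * A := by
  set C : ℝ := (2 * N + 2) * A with hC
  have hC0 : 0 < C := by positivity
  have hmem : ∀ x : Fin N → ℝ, x ∈ Metric.closedBall y 1 ↔ ∀ j, |x j - y j| ≤ 1 := fun x => by
    rw [Metric.mem_closedBall, dist_pi_le_iff zero_le_one]; rfl
  set e : Fin N → ℝ := fun j => if j = i then -1 else 1 with he
  set c : Fin N → ℝ := fun j => if j = i then 2 * y i else 0 with hc
  have hee : ∀ j, e j * e j = 1 := fun j => by simp only [he]; split_ifs <;> norm_num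
  set σ : (Fin N → ℝ) → (Fin N → ℝ) := fun x j => e j * x j + c j with hσ
  have hσc : Continuous σ := by fun_prop
  have hσi : ∀ x, σ x i = 2 * y i - x i := fun x => by simp [hσ, he, hc]; ring
  have hσj : ∀ x j, j ≠ i → σ x j = x j := fun x j hj => by simp [hσ, he, hc, hj]
  have hσm : ∀ x ∈ Metric.closedBall y 1, σ x ∈ Metric.closedBall y 1 := fun x hx => by
    rw [hmem] at hx ⊢
    intro j
    by_cases hj : j = i
    · subst hj
      rw [hσi, abs_sub_comm]
      convert hx j using 2
      ring
    · rw [hσj x j hj]; exact hx j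
  set Φ : (Fin N → ℝ) → ℝ := fun x =>
    (A * sqd y x + C / 2 * ((x i - y i) * (2 - (x i - y i)))) - 1 / 2 * (w x - w (σ x)) with hΦ
  set K : Set (Fin N → ℝ) := Metric.closedBall y 1 ∩ {x | y i ≤ x i} with hK
  have hKc : IsCompact K := (isCompact_closedBall y 1).inter_right
    (isClosed_le continuous_const (continuous_apply i))
  have hsub : K ⊆ Metric.closedBall y 1 := inter_subset_left
  have hΦc : ContinuousOn Φ K := by
    have h1 : ContinuousOn w K := hcont.mono hsub
    have h2 : ContinuousOn (fun x => w (σ x)) K :=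
      hcont.comp hσc.continuousOn fun x hx => hσm x (hsub hx)
    have h3 := continuous_sqd y
    refine ContinuousOn.sub (Continuous.continuousOn (by fun_prop)) ?_
    exact continuousOn_const.mul (h1.sub h2)
  have hyK : y ∈ K := ⟨Metric.mem_closedBall_self zero_le_one, le_refl (y i)⟩
  obtain ⟨z, hz, hmin⟩ := hKc.exists_isMinOn ⟨y, hyK⟩ hΦc
  have hle : ∀ x ∈ K, Φ z ≤ Φ x := fun x hx => hmin hx
  have hzb := (hmem z).1 hz.1
  have hzi : y i ≤ z i := hz.2
  have hzi1 := (abs_le.1 (hzb i)).2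
  have hsq := sqd_nonneg y z
  have hwz := abs_le.1 (hbd z hz.1)
  have hwσ := abs_le.1 (hbd _ (hσm z hz.1))
  have hpos : 0 ≤ Φ z := by
    by_contra! hneg
    have hmid : 0 ≤ C / 2 * ((z i - y i) * (2 - (z i - y i))) := by
      apply mul_nonneg (by positivity)
      apply mul_nonneg <;> linarith
    have hzi' : y i < z i := by
      refine lt_of_le_of_ne hzi fun h => ?_
      have : σ z = z := by
        ext j
        by_cases hj : j = i
        · subst hj; rw [hσi, h]; ring
        · exact hσj z j hj
      simp only [hΦ, this, ← h] at hneg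
      nlinarith
    have hint : ∀ j, |z j - y j| < 1 := fun j => by
      refine lt_of_le_of_ne (hzb j) fun h => ?_
      have h1 := sq_le_sqd y z j
      rw [← sq_abs, h, one_pow] at h1
      simp only [hΦ] at hneg
      nlinarith
    have hlm : IsLocalMin Φ z := by
      have h1 : ∀ᶠ x in nhds z, ∀ j, |x j - y j| < 1 := by
        rw [eventually_all]
        intro j
        have : ContinuousAt (fun x : Fin N → ℝ => |x j - y j|) z :=
          Continuous.continuousAt (by fun_prop)
        exact this.eventually_lt continuousAt_const (hint j)
      have h2 : ∀ᶠ x in nhds z, y i < x i :=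
        (continuousAt_const).eventually_lt (continuous_apply i).continuousAt hzi'
      filter_upwards [h1, h2] with x hx1 hx2
      exact hle x ⟨(hmem x).2 fun j => (hx1 j).le, hx2.le⟩
    obtain ⟨L1, hL1, hL1b⟩ := hlap z hz.1
    obtain ⟨L2, hL2, hL2b⟩ := hlap _ (hσm z hz.1)
    have hq := hasLap_radial (G := fun s => s) (G' := fun _ => 1) (G'' := fun _ => 0)
      (fun s => hasDerivAt_id s) (fun s => hasDerivAt_const s 1) y z
    have hlin : HasLap (fun x => C / 2 * ((x i - y i) * (2 - (x i - y i)))) z (C / 2 * (-2)) := by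
      refine HasLap.const_mul _ ⟨fun j => if j = i then -2 else 0, fun j => ?_, by simp⟩
      by_cases hj : j = i
      · subst hj
        simp only [Function.update_self, if_true]
        refine ⟨fun t => 2 - 2 * (t - y j), Eventually.of_forall fun t => ?_, ?_⟩
        · have h := (hasDerivAt_id t).sub_const (y j)
          have := h.mul (h.const_sub 2)
          refine HasDerivAt.congr_deriv this ?_
          simp; ring
        · have := (((hasDerivAt_id (z j)).sub_const (y j)).const_mul 2).const_sub 2
          refine HasDerivAt.congr_deriv this ?_
          simp
      · simp only [Function.update_of_ne (Ne.symm hj), if_neg hj]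
        exact hasD2_const _ _
    have h0 := (((hq.const_mul A).add hlin).sub
      ((hL1.sub (hL2.comp_affine hee)).const_mul (1 / 2))).nonneg hlm
    have := abs_le.1 hL1b
    have := abs_le.1 hL2b
    nlinarith
  have hΦnn : ∀ x ∈ K, 0 ≤ Φ x := fun x hx => hpos.trans (hle x hx)
  have hD2 : HasDerivAt (fun t => w (Function.update y i (2 * y i - t))) (-D) (y i) := by
    have h1 : HasDerivAt (fun t : ℝ => 2 * y i - t) (-1) (y i) := by
      simpa using (hasDerivAt_id (y i)).const_sub (2 * y i)
    have h2 : 2 * y i - y i = y i := by ring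
    have := HasDerivAt.comp (y i) (h₂ := fun t => w (Function.update y i t)) (by rwa [h2]) h1
    simpa [Function.comp_def] using this
  set g : ℝ → ℝ := fun t => A * (t - y i) ^ 2 + C / 2 * ((t - y i) * (2 - (t - y i))) -
    1 / 2 * (w (Function.update y i t) - w (Function.update y i (2 * y i - t))) with hg
  have hg0 : g (y i) = 0 := by
    have h2 : 2 * y i - y i = y i := by ring
    simp [hg, h2]
  have hgd : HasDerivAt g (C - D) (y i) := by
    have h := (hasDerivAt_id (y i)).sub_const (y i)
    have := (((h.pow 2).const_mul A).add ((h.mul (h.const_sub 2)).const_mul (C / 2))).sub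
      ((hD.sub hD2).const_mul (1 / 2))
    refine HasDerivAt.congr_deriv this ?_
    simp; ring
  have hgnn : ∀ t ∈ Ioc (y i) (y i + 1), 0 ≤ g t := fun t ht => by
    have hin : Function.update y i t ∈ K := by
      refine ⟨(hmem _).2 fun j => ?_, by simpa using ht.1.le⟩
      by_cases hj : j = i
      · subst hj
        rw [Function.update_self, abs_le]
        constructor <;> linarith [ht.1, ht.2]
      · simp [hj]
    have h1 := hΦnn _ hin
    have h2 : σ (Function.update y i t) = Function.update y i (2 * y i - t) := by
      ext j
      by_cases hj : j = i
      · subst hj; rw [hσi]; simp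
      · rw [hσj _ _ hj]; simp [hj]
    simp only [hΦ, h2, sqd_update, sqd_self, Function.update_self] at h1
    simp only [hg]
    linarith
  have h := (hasDerivWithinAt_iff_tendsto_slope' (s := Ioi (y i)) (by simp)).1
    (hgd.hasDerivWithinAt (s := Ioi (y i)))
  have : 0 ≤ C - D := by
    refine ge_of_tendsto h ?_
    filter_upwards [Ioc_mem_nhdsGT (show y i < y i + 1 by linarith)] with t ht
    rw [slope_def_field, hg0, sub_zero]
    exact div_nonneg (hgnn t ht) (by linarith [ht.1])
  linarith

/-- Interior gradient bound for the Poisson equation. -/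
lemma gradient_bound {w : (Fin N → ℝ) → ℝ} {y : Fin N → ℝ} {i : Fin N} {A D : ℝ}
    (hA : 0 < A) (hcont : ContinuousOn w (Metric.closedBall y 1))
    (hbd : ∀ x ∈ Metric.closedBall y 1, |w x| ≤ A)
    (hlap : ∀ x ∈ Metric.closedBall y 1, ∃ L, HasLap w x L ∧ |L| ≤ A)
    (hD : HasDerivAt (fun t => w (Function.update y i t)) D (y i)) :
    |D| ≤ (2 * N + 2) * A := by
  refine abs_le.2 ⟨?_, gradient_bound_above hA hcont hbd hlap hD⟩
  have := gradient_bound_above (w := fun x => -w x) (D := -D) hA hcont.neg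
    (fun x hx => by simpa using hbd x hx)
    (fun x hx => by
      obtain ⟨L, hL, hLb⟩ := hlap x hx
      exact ⟨-L, hL.neg, by simpa using hLb⟩) hD.neg
  linarith

end Comparison

section Derivatives

variable {N : ℕ}

lemma HasLap.comp_add {w : (Fin N → ℝ) → ℝ} {x c : Fin N → ℝ} {L : ℝ} (hw : HasLap w (x + c) L) :
    HasLap (fun x => w (x + c)) x L := by
  have h1 : ∀ y : Fin N → ℝ, (fun i => 1 * y i + c i) = y + c := fun y => by ext; simp
  have := HasLap.comp_affine (w := w) (x := x) (L := L) (e := fun _ => 1) (c := c)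
    (fun _ => one_mul 1) (by rwa [h1])
  simpa only [h1] using this

lemma hasLap_lap {u : (Fin N → ℝ) → ℝ} {x : Fin N → ℝ} (h : ContDiffAt ℝ 2 u x) :
    HasLap u x (lap u x) := by
  refine ⟨fun i => pd i (pd i u) x, fun i => ?_, rfl⟩
  set s : ℝ → ℝ := fun t => u (Function.update x i t) with hs
  have hs2 : ContDiffAt ℝ 2 s (x i) := by
    have h1 : ContDiffAt ℝ 2 u (Function.update x i (x i)) := by rwa [Function.update_eq_self]
    exact h1.comp (x i) (contDiff_update 2 x i).contDiffAt
  have hpd : pd i (pd i u) x = deriv (deriv s) (x i) := by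
    simp [pd, hs, Function.update_idem]
  show HasD2 s (pd i (pd i u) x) (x i)
  rw [hpd]
  refine ⟨deriv s, ?_, ?_⟩
  · filter_upwards [hs2.eventually (by simp)] with t ht
    exact (ht.differentiableAt (by simp)).hasDerivAt
  · have h1 : ContDiffAt ℝ 1 (fun t => fderiv ℝ s t 1) (x i) :=
      (hs2.fderiv_right (m := 1) (by norm_num)).clm_apply contDiffAt_const
    exact (h1.differentiableAt (by simp)).hasDerivAt

lemma hasDerivAt_update_pd {u : (Fin N → ℝ) → ℝ} {x : Fin N → ℝ} (h : DifferentiableAt ℝ u x)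
    (i : Fin N) : HasDerivAt (fun t => u (Function.update x i t)) (pd i u x) (x i) := by
  have h1 : DifferentiableAt ℝ u (Function.update x i (x i)) := by rwa [Function.update_eq_self]
  exact (h1.comp (x i) (hasDerivAt_update x i (x i)).differentiableAt).hasDerivAt

lemma pd_eq_fderiv {u : (Fin N → ℝ) → ℝ} {x : Fin N → ℝ} (h : DifferentiableAt ℝ u x)
    (i : Fin N) : pd i u x = fderiv ℝ u x (Pi.single i 1) := by
  have h1 : HasFDerivAt u (fderiv ℝ u x) (Function.update x i (x i)) := by
    rw [Function.update_eq_self]; exact h.hasFDerivAt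
  exact (h1.comp_hasDerivAt (x i) (hasDerivAt_update x i (x i))).deriv

lemma differentiableAt_pd {u : (Fin N → ℝ) → ℝ} {x : Fin N → ℝ} (h : ContDiffAt ℝ 2 u x)
    (i : Fin N) : DifferentiableAt ℝ (pd i u) x := by
  have h1 : ContDiffAt ℝ 1 (fun y => fderiv ℝ u y (Pi.single i 1)) x :=
    (h.fderiv_right (m := 1) (by norm_num)).clm_apply contDiffAt_const
  refine (h1.differentiableAt (by simp)).congr_of_eventuallyEq ?_
  filter_upwards [h.eventually (by simp)] with y hy
  exact pd_eq_fderiv (hy.differentiableAt (by simp)) i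

lemma norm_fderiv_le_of_pd {u : (Fin N → ℝ) → ℝ} {x : Fin N → ℝ} (h : DifferentiableAt ℝ u x)
    {K : ℝ} (hK0 : 0 ≤ K) (hK : ∀ i, |pd i u x| ≤ K) : ‖fderiv ℝ u x‖ ≤ N * K := by
  refine ContinuousLinearMap.opNorm_le_bound _ (by positivity) fun v => ?_
  have hv : v = ∑ i, v i • (Pi.single i 1 : Fin N → ℝ) := by
    ext j; simp [Finset.sum_apply, Pi.single_apply]
  conv_lhs => rw [hv]
  rw [map_sum]
  refine (norm_sum_le _ _).trans ?_
  calc ∑ i, ‖fderiv ℝ u x (v i • (Pi.single i 1 : Fin N → ℝ))‖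
      ≤ ∑ _i : Fin N, K * ‖v‖ := by
        refine Finset.sum_le_sum fun i _ => ?_
        rw [map_smul, norm_smul, ← pd_eq_fderiv h, mul_comm]
        exact mul_le_mul (hK i) (norm_le_pi_norm v i) (norm_nonneg _) hK0
    _ = N * K * ‖v‖ := by simp [mul_assoc]

lemma abs_sub_le_of_pd {u : (Fin N → ℝ) → ℝ} {i₀ : Fin N} {R K : ℝ}
    (hd : ∀ x, R < x i₀ → DifferentiableAt ℝ u x) (hK0 : 0 ≤ K)
    (hK : ∀ x, R < x i₀ → ∀ i, |pd i u x| ≤ K) {x y : Fin N → ℝ} (hx : R < x i₀)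
    (hy : R < y i₀) : |u x - u y| ≤ N * K * ‖x - y‖ := by
  have hconv : Convex ℝ {x : Fin N → ℝ | R < x i₀} :=
    convex_halfSpace_gt (LinearMap.proj (R := ℝ) (φ := fun _ : Fin N => ℝ) i₀).isLinear R
  exact hconv.norm_image_sub_le_of_norm_fderiv_le (fun z hz => hd z hz)
    (fun z hz => norm_fderiv_le_of_pd (hd z hz) hK0 (hK z hz)) hy hx

lemma lt_of_mem_closedBall {x y : Fin N → ℝ} {R r : ℝ} {i₀ : Fin N} (hy : R + r < y i₀)
    (hx : x ∈ Metric.closedBall y r) : R < x i₀ := by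
  have h1 : |x i₀ - y i₀| ≤ r := (dist_le_pi_dist x y i₀).trans hx
  linarith [(abs_le.1 h1).1]

variable {u : (Fin N → ℝ) → ℝ} {f : ℝ → ℝ} {i₀ : Fin N}

lemma pd_bound {z R A : ℝ} (hA : 0 < A) (hs : ∀ x, R < x i₀ → ContDiffAt ℝ 2 u x)
    (hpde : ∀ x, R < x i₀ → HasLap u x (-f (u x))) (hu : ∀ x, R < x i₀ → |u x - z| ≤ A)
    (hfu : ∀ x, R < x i₀ → |f (u x)| ≤ A) {y : Fin N → ℝ} (hy : R + 1 < y i₀) (i : Fin N) :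
    |pd i u y| ≤ (2 * N + 2) * A := by
  have hb : ∀ x ∈ Metric.closedBall y 1, R < x i₀ := fun x hx => lt_of_mem_closedBall hy hx
  refine gradient_bound (w := fun x => u x - z) (y := y) (i := i) hA ?_ (fun x hx => hu x (hb x hx))
    (fun x hx => ⟨-f (u x), ?_, by rw [abs_neg]; exact hfu x (hb x hx)⟩) ?_
  · exact fun x hx => ((hs x (hb x hx)).continuousAt.sub continuousAt_const).continuousWithinAt
  · simpa using (hpde x (hb x hx)).sub (hasLap_const z x)
  · exact (hasDerivAt_update_pd ((hs y (by linarith)).differentiableAt (by simp)) i).sub_const z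

lemma pd_pd_bound {R A B ℓ : ℝ} (hA : 0 < A) (hB : 0 ≤ B) (hℓ : 0 ≤ ℓ)
    (hs : ∀ x, R < x i₀ → ContDiffAt ℝ 2 u x)
    (hpde : ∀ x, R < x i₀ → HasLap u x (-f (u x)))
    (hlip : ∀ x y, R < x i₀ → R < y i₀ → |f (u x) - f (u y)| ≤ ℓ * |u x - u y|)
    (hpd : ∀ x, R < x i₀ → ∀ i, |pd i u x| ≤ B) (hBA : N * B ≤ A) (hBA' : ℓ * (N * B) ≤ A)
    {y : Fin N → ℝ} (hy : R + 1 < y i₀) (i j : Fin N) :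
    |pd i (pd j u) y| ≤ (2 * N + 2) * A := by
  have hd : ∀ x, R < x i₀ → DifferentiableAt ℝ u x := fun x hx =>
    (hs x hx).differentiableAt (by simp)
  have hyR : R < y i₀ := by linarith
  have key : ∀ h : ℝ, 0 < h →
      |(pd j u (y + Pi.single i h) - pd j u y) / h| ≤ (2 * N + 2) * A := fun h hh => by
    set c : Fin N → ℝ := Pi.single i h with hc
    have hc0 : 0 ≤ c i₀ := by
      rw [hc, Pi.single_apply]; split_ifs <;> linarith
    have hcn : ‖c‖ = h := by rw [hc, Pi.norm_single, Real.norm_of_nonneg hh.le]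
    have hb : ∀ x ∈ Metric.closedBall y 1, R < x i₀ := fun x hx => lt_of_mem_closedBall hy hx
    have hb' : ∀ x : Fin N → ℝ, R < x i₀ → R < (x + c) i₀ := fun x hx => by
      rw [Pi.add_apply]; linarith
    have hdiff : ∀ x, R < x i₀ → |u (x + c) - u x| ≤ N * B * h := fun x hx => by
      have := abs_sub_le_of_pd hd hB hpd (hb' x hx) hx
      rwa [add_sub_cancel_left, hcn] at this
    have hderiv : HasDerivAt
        (fun t => 1 / h * (u (Function.update y j t + c) - u (Function.update y j t)))
        (1 / h * (pd j u (y + c) - pd j u y)) (y j) := by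
      refine (HasDerivAt.sub ?_ (hasDerivAt_update_pd (hd y hyR) j)).const_mul _
      have h1 := hasDerivAt_update_pd (hd _ (hb' y hyR)) j
      have h2 := HasDerivAt.comp_add_const (y j) (c j) h1
      convert h2 using 3 with t
      ext k
      by_cases hk : k = j
      · subst hk; simp
      · simp [hk]
    rw [div_eq_inv_mul, inv_eq_one_div]
    refine gradient_bound (w := fun x => 1 / h * (u (x + c) - u x)) hA ?_ (fun x hx => ?_)
      (fun x hx => ⟨_, ((hpde _ (hb' x (hb x hx))).comp_add.sub
        (hpde x (hb x hx))).const_mul (1 / h), ?_⟩) hderiv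
    · intro x hx
      have h1 : ContinuousAt (fun x => u (x + c)) x :=
        ContinuousAt.comp (g := u) (hs _ (hb' x (hb x hx))).continuousAt
          (continuous_id.add continuous_const).continuousAt
      exact (continuousAt_const.mul (h1.sub (hs x (hb x hx)).continuousAt)).continuousWithinAt
    · rw [abs_mul, abs_of_pos (by positivity : 0 < 1 / h), one_div, inv_mul_le_iff₀ hh]
      have := hdiff x (hb x hx)
      nlinarith
    · rw [abs_mul, abs_of_pos (by positivity : 0 < 1 / h), one_div, inv_mul_le_iff₀ hh]
      have h1 := hdiff x (hb x hx)
      have h2 := hlip _ _ (hb' x (hb x hx)) (hb x hx)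
      rw [show -f (u (x + c)) - -f (u x) = -(f (u (x + c)) - f (u x)) by ring, abs_neg]
      have h3 := mul_le_mul_of_nonneg_left h1 hℓ
      nlinarith
  have hder := hasDerivAt_update_pd (differentiableAt_pd (hs y hyR) j) i
  have hlim := ((hasDerivWithinAt_iff_tendsto_slope' (s := Ioi (y i)) (by simp)).1
    (hder.hasDerivWithinAt (s := Ioi (y i)))).abs
  refine le_of_tendsto hlim ?_
  filter_upwards [self_mem_nhdsWithin] with t ht
  have h1 := key (t - y i) (sub_pos.2 ht)
  have h2 : y + Pi.single i (t - y i) = Function.update y i t := by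
    ext k
    by_cases hk : k = i
    · subst hk; simp
    · simp [hk]
  rw [slope_def_field, Function.update_eq_self]
  rwa [h2] at h1

/-- Uniform convergence of a solution at infinity implies convergence in `C²`. -/
lemma c2ConvOn_of_uniform {z : ℝ} {ℓ : NNReal} {C : ℝ} (hN : 0 < N) (hfz : f z = 0)
    (hz : z ∈ Icc 0 C) (hℓ : LipschitzOnWith ℓ f (Icc 0 C))
    (hs : ∀ x, 0 < x i₀ → ContDiffAt ℝ 2 u x)
    (hpde : ∀ x, 0 < x i₀ → HasLap u x (-f (u x)))
    (hb : ∀ x, 0 < x i₀ → u x ∈ Icc 0 C)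
    (hlim : ∀ ε > 0, ∃ R, ∀ x : Fin N → ℝ, R < x i₀ → |u x - z| ≤ ε) (A : ℝ) :
    C2ConvOn i₀ u {x | A ≤ x i₀} (fun _ => z) (fun _ _ => 0) (fun _ _ _ => 0) := by
  have hN' : (0 : ℝ) < N := by exact_mod_cast hN
  have hℓ0 : (0 : ℝ) ≤ ℓ := ℓ.2
  have hlip : ∀ s ∈ Icc 0 C, ∀ t ∈ Icc 0 C, |f s - f t| ≤ ℓ * |s - t| := fun s hs t ht =>
    hℓ.dist_le_mul s hs t ht
  have conv : ∀ (g : (Fin N → ℝ) → ℝ) (a : ℝ),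
      (∀ ε > 0, ∃ R, ∀ x : Fin N → ℝ, R < x i₀ → |g x - a| ≤ ε) →
      TendstoUniformlyOn (fun (h : ℝ) x => g (Function.update x i₀ (x i₀ + h))) (fun _ => a)
        atTop {x | A ≤ x i₀} := fun g a hg => by
    rw [Metric.tendstoUniformlyOn_iff]
    intro ε hε
    obtain ⟨R, hR⟩ := hg (ε / 2) (by positivity)
    filter_upwards [eventually_gt_atTop (R - A)] with h hh x hx
    have hx' : A ≤ x i₀ := hx
    have := hR (Function.update x i₀ (x i₀ + h)) (by simp; linarith)
    rw [dist_comm, Real.dist_eq]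
    linarith
  have hgrad : ∀ ε > 0, ∃ R ≥ 0, ∀ x : Fin N → ℝ, R < x i₀ → ∀ i, |pd i u x| ≤ ε := by
    intro ε hε
    set A' := ε / (2 * N + 2) with hA'
    obtain ⟨R, hR⟩ := hlim (A' / (1 + ℓ)) (by positivity)
    have h1 : A' / (1 + ℓ) ≤ A' := div_le_self (by positivity) (by linarith)
    have h2 : ℓ * (A' / (1 + ℓ)) ≤ A' := by
      rw [← mul_div_assoc, div_le_iff₀ (by positivity)]
      have : 0 < A' := by positivity
      nlinarith
    refine ⟨max R 0 + 1, by positivity, fun x hx i => ?_⟩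
    have hR0 : ∀ x : Fin N → ℝ, max R 0 < x i₀ → R < x i₀ ∧ 0 < x i₀ := fun x hx => max_lt_iff.1 hx
    have := pd_bound (f := f) (z := z) (R := max R 0) (A := A') (by positivity)
      (fun x hx => hs x (hR0 x hx).2) (fun x hx => hpde x (hR0 x hx).2)
      (fun x hx => (hR x (hR0 x hx).1).trans h1)
      (fun x hx => by
        have h3 := hlip _ (hb x (hR0 x hx).2) z hz
        rw [hfz, sub_zero] at h3
        exact h3.trans ((mul_le_mul_of_nonneg_left (hR x (hR0 x hx).1) hℓ0).trans h2)) hx i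
    rwa [hA', mul_div_cancel₀ _ (by positivity)] at this
  refine ⟨conv u z hlim, fun i => conv _ 0 fun ε hε => ?_, fun i j => conv _ 0 fun ε hε => ?_⟩
  · obtain ⟨R, -, hR⟩ := hgrad ε hε
    exact ⟨R, fun x hx => by simpa using hR x hx i⟩
  · set A' := ε / (2 * N + 2) with hA'
    have hA'0 : 0 < A' := by positivity
    set B := A' / (N * (1 + ℓ)) with hB
    obtain ⟨R, hR0, hR⟩ := hgrad B (by positivity)
    have h1 : N * B = A' / (1 + ℓ) := by rw [hB]; field_simp
    refine ⟨R + 1, fun x hx => ?_⟩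
    have := pd_pd_bound (f := f) (R := R) (A := A') (B := B) (ℓ := ℓ) hA'0 (by positivity) hℓ0
      (fun x hx => hs x (by linarith)) (fun x hx => hpde x (by linarith))
      (fun x y hx hy => hlip _ (hb x (by linarith)) _ (hb y (by linarith))) hR
      (by rw [h1]; exact div_le_self hA'0.le (by linarith))
      (by
        rw [h1, ← mul_div_assoc, div_le_iff₀ (by positivity)]
        nlinarith) hx i j
    rw [hA', mul_div_cancel₀ _ (by positivity)] at this
    simpa using this

end Derivatives

section HalfSpace

variable {N : ℕ} {u : (Fin N → ℝ) → ℝ} {f : ℝ → ℝ} {i₀ : Fin N}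

lemma isPreconnected_halfSpace (i₀ : Fin N) (R : ℝ) : IsPreconnected {x : Fin N → ℝ | R < x i₀} :=
  (convex_halfSpace_gt
    (LinearMap.proj (R := ℝ) (φ := fun _ : Fin N => ℝ) i₀).isLinear R).isPreconnected

lemma lt_of_sqd_le {y x : Fin N → ℝ} {R r : ℝ} (hr : 0 ≤ r) (hy : R + r < y i₀)
    (hx : sqd y x ≤ r ^ 2) : R < x i₀ := by
  linarith [(abs_le.1 (abs_sub_le_of_sqd_le hr hx i₀)).1]

/-- Strong maximum principle: a nonnegative solution which is positive somewhere is positive. -/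
lemma pos_of_exists_pos [NeZero N] {μ : ℝ} (hμ : 0 < μ) (hf : ∀ s, 0 ≤ s → s < μ → 0 ≤ f s)
    (hs : ∀ x, 0 < x i₀ → ContDiffAt ℝ 2 u x)
    (hpde : ∀ x, 0 < x i₀ → HasLap u x (-f (u x))) (hnn : ∀ x, 0 < x i₀ → 0 ≤ u x)
    (hex : ∃ p, 0 < p i₀ ∧ 0 < u p) : ∀ x, 0 < x i₀ → 0 < u x := by
  set U : Set (Fin N → ℝ) := {x | 0 < x i₀ ∧ 0 < u x} with hU
  have hUo : IsOpen U := by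
    rw [isOpen_iff_mem_nhds]
    rintro x ⟨hx, hux⟩
    have h1 : ∀ᶠ y in nhds x, 0 < y i₀ :=
      continuousAt_const.eventually_lt (continuous_apply i₀).continuousAt hx
    have h2 : ∀ᶠ y in nhds x, 0 < u y :=
      continuousAt_const.eventually_lt (hs x hx).continuousAt hux
    exact h1.and h2
  have hsub : {x : Fin N → ℝ | 0 < x i₀} ⊆ U := by
    refine (isPreconnected_halfSpace i₀ 0).subset_of_closure_inter_subset hUo ?_ ?_
    · obtain ⟨p, hp, hup⟩ := hex
      exact ⟨p, hp, hp, hup⟩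
    · rintro x ⟨hxU, hx⟩
      have hx : 0 < x i₀ := hx
      refine ⟨hx, ?_⟩
      have hopen : IsOpen {p : Fin N → ℝ | sqd p x < (p i₀) ^ 2 ∧ 0 < p i₀} :=
        (isOpen_lt (continuous_sqd_left x) ((continuous_apply i₀).pow 2)).inter
          (isOpen_lt continuous_const (continuous_apply i₀))
      obtain ⟨p, ⟨hp1, hp2⟩, -, hup⟩ := mem_closure_iff.1 hxU _ hopen
        ⟨by rw [sqd_self]; positivity, hx⟩
      obtain ⟨b, hb1, hb2⟩ := exists_between hp1
      set r := Real.sqrt b with hr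
      have hb0 : 0 ≤ b := (sqd_nonneg p x).trans hb1.le
      have hrb : r ^ 2 = b := Real.sq_sqrt hb0
      have hrp : 0 + r < p i₀ := by
        rw [zero_add]
        exact lt_of_pow_lt_pow_left₀ 2 hp2.le (by rwa [hrb])
      have hin : ∀ y, sqd p y ≤ b → 0 < y i₀ := fun y hy =>
        lt_of_sqd_le (Real.sqrt_nonneg b) hrp (by rwa [← hr, hrb])
      set ε := min (u p / 2) μ with hε
      have hε0 : 0 < ε := lt_min (by linarith) hμ
      have hεp : ε < u p := (min_le_left _ _).trans_lt (by linarith)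
      obtain ⟨ρ, hρ, hball⟩ := Metric.eventually_nhds_iff.1
        (continuousAt_const.eventually_lt (hs p hp2).continuousAt hεp)
      obtain ⟨κ, hκ, hprop⟩ := exists_propagation_const (N := N) (a := (ρ / 2) ^ 2)
        (by positivity) hb1
      refine lt_of_lt_of_le (mul_pos hε0 hκ) (hprop u p ε hε0
        (fun y hy => (hs y (hin y hy)).continuousAt.continuousWithinAt)
        (fun y hy => hnn y (hin y hy)) (fun y hy => ?_) (fun y hy hyε => ?_) x le_rfl)
      · refine (hball ?_).le
        refine lt_of_le_of_lt ?_ (show ρ / 2 < ρ by linarith)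
        rw [dist_pi_le_iff (by positivity)]
        exact fun i => abs_sub_le_of_sqd_le (by positivity) hy i
      · have hy0 := hin y hy.le
        exact ⟨-f (u y), neg_nonpos.2 (hf _ (hnn y hy0) (hyε.trans_le (min_le_right _ _))),
          hpde y hy0⟩
  exact fun x hx => (hsub hx).2

lemma exists_radius (N : ℕ) {c : ℝ} (hc : 0 < c) :
    ∃ R > 0, (8 + 4 * (N : ℝ)) ^ 2 < 32 * R ^ 2 * c := by
  refine ⟨(8 + 4 * N) / c + (8 + 4 * N), by positivity, ?_⟩
  have h : (0 : ℝ) < 8 + 4 * N := by positivity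
  set k : ℝ := 8 + 4 * N
  have h1 : (k / c + k) ^ 2 * c = k ^ 2 / c + 2 * k ^ 2 + k ^ 2 * c := by field_simp; ring
  have h2 : 0 < k ^ 2 / c := by positivity
  have h3 : 0 < k ^ 2 * c := by positivity
  nlinarith

/-- A positive solution is eventually above any level below which `f` dominates a linear
function. -/
lemma eventually_ge_of_linear_lower_bound {c δ : ℝ} (hc : 0 < c) (hδ : 0 < δ)
    (hf : ∀ s, 0 < s → s < δ → c * s ≤ f s)
    (hs : ∀ x, 0 < x i₀ → ContDiffAt ℝ 2 u x)
    (hpde : ∀ x, 0 < x i₀ → HasLap u x (-f (u x))) (hpos : ∀ x, 0 < x i₀ → 0 < u x) :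
    ∃ R, ∀ x, R < x i₀ → δ ≤ u x := by
  obtain ⟨R, hR, hRc⟩ := exists_radius N hc
  refine ⟨R, fun y hy => ?_⟩
  have hin : ∀ x, sqd y x ≤ R ^ 2 → 0 < x i₀ := fun x hx =>
    lt_of_sqd_le hR.le (by rwa [zero_add]) hx
  refine le_center_of_supersolution hR hRc hδ
    (fun x hx => (hs x (hin x hx)).continuousAt.continuousWithinAt)
    (fun x hx => hpos x (hin x hx))
    (fun x hx hxδ => ⟨_, hpde x (hin x hx.le), ?_⟩)
  linarith [hf (u x) (hpos x (hin x hx.le)) hxδ]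

/-- The upper limit at infinity in the direction `i₀`. -/
lemma exists_limsup {C : ℝ} (hb : ∀ x, 0 < x i₀ → u x ∈ Icc 0 C) :
    ∃ M, (∀ ε > 0, ∃ R ≥ 0, ∀ x, R < x i₀ → u x < M + ε) ∧
      (∀ ε > 0, ∀ R, ∃ x, R < x i₀ ∧ M - ε < u x) := by
  set S : Set ℝ := {a | ∃ R, ∀ x, R < x i₀ → u x ≤ a} with hS
  have hlow : ∀ a ∈ S, 0 ≤ a := by
    rintro a ⟨R, hR⟩
    exact (hb (fun _ => max R 0 + 1) (by positivity)).1.trans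
      (hR _ (by linarith [le_max_left R 0]))
  have hne : S.Nonempty := ⟨C, 0, fun x hx => (hb x hx).2⟩
  have hbdd : BddBelow S := ⟨0, hlow⟩
  refine ⟨sInf S, fun ε hε => ?_, fun ε hε R => ?_⟩
  · obtain ⟨a, ⟨R, hR⟩, ha⟩ := exists_lt_of_csInf_lt hne (lt_add_of_pos_right (sInf S) hε)
    exact ⟨max R 0, le_max_right _ _, fun x hx =>
      (hR x ((le_max_left _ _).trans_lt hx)).trans_lt ha⟩
  · by_contra! h
    have := csInf_le hbdd (show sInf S - ε ∈ S from ⟨R, h⟩)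
    linarith

/-- The reaction term cannot be negative at the upper limit at infinity. -/
lemma nonneg_of_limsup {C M : ℝ} (hM : M ∈ Icc 0 C) (hfc : ContinuousOn f (Icc 0 C))
    (hs : ∀ x, 0 < x i₀ → ContDiffAt ℝ 2 u x)
    (hpde : ∀ x, 0 < x i₀ → HasLap u x (-f (u x))) (hb : ∀ x, 0 < x i₀ → u x ∈ Icc 0 C)
    (hM1 : ∀ ε > 0, ∃ R ≥ 0, ∀ x, R < x i₀ → u x < M + ε)
    (hM2 : ∀ ε > 0, ∀ R, ∃ x, R < x i₀ ∧ M - ε < u x) : 0 ≤ f M := by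
  by_contra! hneg
  obtain ⟨η, hη, hfη⟩ := Metric.continuousWithinAt_iff.1 (hfc M hM) (-f M / 2) (by linarith)
  set ε := -f M / (8 * (N + 1)) with hε
  have hε0 : 0 < ε := div_pos (by linarith) (by positivity)
  have hεN : 2 * N * ε < -f M / 2 := by
    have : ε * (8 * (N + 1)) = -f M := div_mul_cancel₀ _ (by positivity)
    nlinarith
  set θ := min (ε / 4) (η / 2) with hθ
  have hθ0 : 0 < θ := lt_min (by positivity) (by positivity)
  have hθε : θ ≤ ε / 4 := min_le_left _ _
  have hθη : θ ≤ η / 2 := min_le_right _ _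
  obtain ⟨R, hR0, hR⟩ := hM1 θ hθ0
  obtain ⟨y, hy, huy⟩ := hM2 θ hθ0 (R + 1)
  have hin : ∀ x, sqd y x ≤ 1 → R < x i₀ := fun x hx =>
    lt_of_sqd_le zero_le_one hy (by rwa [one_pow])
  have hin0 : ∀ x, sqd y x ≤ 1 → 0 < x i₀ := fun x hx => hR0.trans_lt (hin x hx)
  have hqc := continuous_sqd y
  obtain ⟨z, hz, hmin⟩ := (isCompact_sqd_le y 1).exists_isMinOn
    ⟨y, show sqd y y ≤ 1 by rw [sqd_self]; exact zero_le_one⟩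
    (f := fun x => ε * sqd y x - u x)
    (ContinuousOn.sub (Continuous.continuousOn (by fun_prop))
      fun x hx => (hs x (hin0 x hx)).continuousAt.continuousWithinAt)
  have hz' : sqd y z ≤ 1 := hz
  have hle : ∀ x, sqd y x ≤ 1 → ε * sqd y z - u z ≤ ε * sqd y x - u x := fun x hx => hmin hx
  have hzy := hle y (by rw [sqd_self]; exact zero_le_one)
  rw [sqd_self] at hzy
  have huz := hR z (hin z hz')
  have hq0 := sqd_nonneg y z
  have hz1 : sqd y z < 1 := by
    refine lt_of_le_of_ne hz' fun h => ?_
    rw [h] at hzy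
    linarith
  have hlm : IsLocalMin (fun x => ε * sqd y x - u x) z := by
    have hnhds : ∀ᶠ x in nhds z, sqd y x < 1 :=
      hqc.continuousAt.eventually_lt continuousAt_const hz1
    filter_upwards [hnhds] with x hx using hle x hx.le
  have hq := hasLap_radial (G := fun s => s) (G' := fun _ => 1) (G'' := fun _ => 0)
    (fun s => hasDerivAt_id s) (fun s => hasDerivAt_const s 1) y z
  have h0 := ((hq.const_mul ε).sub (hpde z (hin0 z hz'))).nonneg hlm
  have huzM : |u z - M| < η := by
    rw [abs_lt]; constructor <;> nlinarith
  have h1 := hfη (hb z (hin0 z hz')) huzM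
  rw [Real.dist_eq, abs_lt] at h1
  nlinarith [h1.2]

/-- If `f` is nonpositive on `[μ, ∞)` and dominated by a negative linear function to the left of
the upper limit `M > μ`, then the solution converges uniformly to `M`. -/
lemma uniform_of_limsup [NeZero N] {C M μ c δ : ℝ} (hμM : μ < M) (hc : 0 < c) (hδ : 0 < δ)
    (hfμ : ∀ s, μ ≤ s → f s ≤ 0) (hfM : ∀ s, M - δ < s → s < M → f s ≤ c * (s - M))
    (hfb : ∃ B, ∀ s ∈ Icc 0 C, |f s| ≤ B)
    (hs : ∀ x, 0 < x i₀ → ContDiffAt ℝ 2 u x)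
    (hpde : ∀ x, 0 < x i₀ → HasLap u x (-f (u x))) (hb : ∀ x, 0 < x i₀ → u x ∈ Icc 0 C)
    (hM1 : ∀ ε > 0, ∃ R ≥ 0, ∀ x, R < x i₀ → u x < M + ε)
    (hM2 : ∀ ε > 0, ∀ R, ∃ x, R < x i₀ ∧ M - ε < u x) :
    ∀ ε > 0, ∃ R, ∀ x : Fin N → ℝ, R < x i₀ → |u x - M| ≤ ε := by
  suffices hlow : ∀ ε > 0, ∃ R, ∀ x : Fin N → ℝ, R < x i₀ → M - ε ≤ u x by
    intro ε hε
    obtain ⟨R1, -, hR1⟩ := hM1 ε hε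
    obtain ⟨R2, hR2⟩ := hlow ε hε
    refine ⟨max R1 R2, fun x hx => ?_⟩
    obtain ⟨h1, h2⟩ := max_lt_iff.1 hx
    rw [abs_le]
    constructor <;> linarith [hR1 x h1, hR2 x h2]
  by_contra! hfail
  obtain ⟨d, hd, hfail⟩ := hfail
  obtain ⟨r, hr, hrc⟩ := exists_radius N hc
  set a := min (min d δ) (M - μ) / 2 with ha
  have hm0 : 0 < min (min d δ) (M - μ) := lt_min (lt_min hd hδ) (by linarith)
  have ha0 : 0 < a := by positivity
  have had : a < d := by linarith [(min_le_left (min d δ) (M - μ)).trans (min_le_left _ _)]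
  have haδ : a < δ := by linarith [(min_le_left (min d δ) (M - μ)).trans (min_le_right _ _)]
  have haμ : a < M - μ := by linarith [min_le_right (min d δ) (M - μ)]
  obtain ⟨B, hB⟩ := hfb
  obtain ⟨K, hK0, hK⟩ : ∃ K > 0, ∀ x, 1 < x i₀ → ∀ i, |pd i u x| ≤ K := by
    have hC0 : 0 ≤ C := (hb (fun _ => 1) one_pos).1.trans (hb (fun _ => 1) one_pos).2
    have hB0 : 0 ≤ B := (abs_nonneg _).trans (hB 0 ⟨le_rfl, hC0⟩)
    refine ⟨(2 * N + 2) * (C + B + 1), by positivity, fun x hx i => ?_⟩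
    refine pd_bound (f := f) (z := 0) (R := 0) (by positivity) hs hpde (fun x hx => ?_)
      (fun x hx => ?_) (by rwa [zero_add]) i
    · rw [sub_zero, abs_of_nonneg (hb x hx).1]
      linarith [(hb x hx).2]
    · linarith [hB _ (hb x hx)]
  set ρ := a / (2 * (N * K + 1)) with hρ
  have hρ0 : 0 < ρ := by positivity
  have hρK : N * K * ρ ≤ a / 2 := by
    have : ρ * (2 * (N * K + 1)) = a := div_mul_cancel₀ _ (by positivity)
    nlinarith
  set r' := max r ρ + 1 with hr'
  have hrr' : r < r' := by linarith [le_max_left r ρ]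
  have hρr' : ρ < r' := by linarith [le_max_right r ρ]
  have hr'0 : 0 < r' := hr.trans hrr'
  obtain ⟨κ, hκ, hprop⟩ := exists_propagation_const (N := N) (a := ρ ^ 2) (b' := r ^ 2)
    (b := r' ^ 2) (by positivity) (pow_lt_pow_left₀ hrr' hr.le two_ne_zero)
  set θ := a / 2 * κ / 2 with hθ
  have hθ0 : 0 < θ := by positivity
  obtain ⟨R, hR0, hR⟩ := hM1 θ hθ0
  obtain ⟨y, hy, huy⟩ : ∃ y, R + 1 + r' < y i₀ ∧ u y = M - a := by
    obtain ⟨y1, hy1, huy1⟩ := hfail (R + 1 + r')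
    obtain ⟨y2, hy2, huy2⟩ := hM2 a ha0 (R + 1 + r')
    have hcont : ContinuousOn u {x : Fin N → ℝ | R + 1 + r' < x i₀} := fun x hx => by
      have hx : R + 1 + r' < x i₀ := hx
      exact (hs x (by linarith)).continuousAt.continuousWithinAt
    obtain ⟨y, hy, h⟩ := (isPreconnected_halfSpace i₀ (R + 1 + r')).intermediate_value hy1 hy2
      hcont (show M - a ∈ Icc (u y1) (u y2) from ⟨by linarith, huy2.le⟩)
    exact ⟨y, hy, h⟩
  have hin : ∀ x, sqd y x ≤ r' ^ 2 → R + 1 < x i₀ := fun x hx => lt_of_sqd_le hr'0.le hy hx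
  have hlow : ∀ x, sqd y x ≤ r ^ 2 → a / 2 * κ ≤ M - u x + θ := by
    refine hprop (fun x => M - u x + θ) y (a / 2) (by positivity) (fun x hx => ?_)
      (fun x hx => ?_) (fun x hx => ?_) (fun x hx hlt => ⟨f (u x), ?_, ?_⟩)
    · have hx := hin x hx
      exact ((continuousAt_const.sub (hs x (by linarith)).continuousAt).add
        continuousAt_const).continuousWithinAt
    · linarith [hR x (by linarith [hin x hx])]
    · have hx' := hin x (hx.trans (pow_le_pow_left₀ hρ0.le hρr'.le 2))
      have h1 := abs_sub_le_of_pd (R := 1) (fun x hx => (hs x (by linarith)).differentiableAt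
        (by simp)) hK0.le hK (x := x) (y := y) (by linarith) (by linarith)
      have h2 : ‖x - y‖ ≤ ρ := by
        rw [pi_norm_le_iff_of_nonneg hρ0.le]
        exact fun i => abs_sub_le_of_sqd_le hρ0.le hx i
      have h3 : N * K * ‖x - y‖ ≤ N * K * ρ := mul_le_mul_of_nonneg_left h2 (by positivity)
      linarith [(abs_le.1 h1).2]
    · exact hfμ _ (by linarith)
    · have hx := hin x hx.le
      have h1 := ((hasLap_const (M + θ) x).sub (hpde x (by linarith)))
      simpa [sub_add_eq_add_sub] using h1
  have hpos : ∀ x, sqd y x ≤ r ^ 2 → 0 < M - u x := fun x hx => by linarith [hlow x hx]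
  have hin' : ∀ x, sqd y x ≤ r ^ 2 → 0 < x i₀ := fun x hx => by
    linarith [hin x (hx.trans (pow_le_pow_left₀ hr.le hrr'.le 2))]
  have hfinal := le_center_of_supersolution (v := fun x => M - u x) (y := y) hr hrc hδ
    (fun x hx => (continuousAt_const.sub
      (hs x (hin' x hx)).continuousAt).continuousWithinAt) hpos
    (fun x hx hlt => ⟨f (u x), by simpa using (hasLap_const M x).sub (hpde x (hin' x hx.le)), by
      linarith [hfM (u x) (by linarith) (by linarith [hpos x hx.le])]⟩)
  simp only [huy] at hfinal
  linarith

end HalfSpace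

lemma LocLipOn.continuousOn {f : ℝ → ℝ} (hf : LocLipOn f) (b : ℝ) : ContinuousOn f (Icc 0 b) :=
  (hf b).choose_spec.continuousOn

lemma H1.exists_linear_lower_bound {f : ℝ → ℝ} {μ' μ δ : ℝ} (hf : H1 f μ' μ) (hδ : 0 < δ)
    (hδμ : δ < μ) : ∃ c > 0, ∀ s, 0 < s → s < δ → c * s ≤ f s := by
  obtain ⟨hlip, -, -, hpos, -, -, h0⟩ := hf
  have hcompact : ∀ s₀, 0 ≤ s₀ → s₀ ≤ δ → (∀ s ∈ Icc s₀ δ, 0 < f s) →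
      ∃ c > 0, ∀ s ∈ Icc s₀ δ, c * s ≤ f s := fun s₀ hs₀ hs₀δ hfpos => by
    obtain ⟨z, hz, hmin⟩ := (isCompact_Icc (a := s₀) (b := δ)).exists_isMinOn ⟨δ, hs₀δ, le_rfl⟩
      ((hlip.continuousOn δ).mono (Icc_subset_Icc_left hs₀))
    have hfz := hfpos z hz
    refine ⟨f z / δ, by positivity, fun s hs => ?_⟩
    have h1 : f z ≤ f s := hmin hs
    have h2 : f z / δ * s ≤ f z / δ * δ := mul_le_mul_of_nonneg_left hs.2 (by positivity)
    rw [div_mul_cancel₀ _ hδ.ne'] at h2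
    exact h2.trans h1
  rcases h0 with h0 | ⟨-, c, hc, hev⟩
  · obtain ⟨c, hc, h⟩ := hcompact 0 le_rfl hδ.le fun s hs => by
      rcases hs.1.eq_or_lt with h | h
      · rwa [← h]
      · exact hpos s h (hs.2.trans_lt hδμ)
    exact ⟨c, hc, fun s hs hsδ => h s ⟨hs.le, hsδ.le⟩⟩
  · obtain ⟨η, hη, hIoo⟩ := mem_nhdsGT_iff_exists_Ioo_subset.1 hev
    have hη : 0 < η := hη
    set s₀ := min (η / 2) δ with hs₀
    have hs₀0 : 0 < s₀ := lt_min (by positivity) hδ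
    obtain ⟨c', hc', h⟩ := hcompact s₀ hs₀0.le (min_le_right _ _) fun s hs =>
      hpos s (hs₀0.trans_le hs.1) (hs.2.trans_lt hδμ)
    refine ⟨min c c', lt_min hc hc', fun s hs hsδ => ?_⟩
    rcases lt_or_ge s s₀ with hlt | hge
    · have h1 : c ≤ f s / s := hIoo ⟨hs, by linarith [min_le_left (η / 2) δ]⟩
      rw [le_div_iff₀ hs] at h1
      exact (mul_le_mul_of_nonneg_right (min_le_left _ _) hs.le).trans h1
    · exact (mul_le_mul_of_nonneg_right (min_le_right _ _) hs.le).trans (h s ⟨hge, hsδ.le⟩)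

/-- Theorem 1.4: under (H1) and (H3), any nontrivial bounded nonnegative solution of the
half-space problem converges in `C²`, uniformly on `[A,+∞) × ℝ^{N-1}`, to a constant
`z ≥ μ` with `f(z) = 0`. -/
theorem stmt_4
    (f : ℝ → ℝ) (μ' μ : ℝ) (hf : H1 f μ' μ) (hf3 : H3 f μ)
    {N : ℕ} (hN : 2 ≤ N) (i0 : Fin N) (hi0 : (i0 : ℕ) = 0)
    (u u₀ : (Fin N → ℝ) → ℝ)
    (hu_smooth : ContDiffOn ℝ 2 u {x : Fin N → ℝ | 0 < x i0})
    (hu_cont : ContinuousOn u {x : Fin N → ℝ | 0 ≤ x i0})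
    (hu_nonneg : ∀ x : Fin N → ℝ, 0 ≤ x i0 → 0 ≤ u x)
    (hu_bdd : ∃ C, ∀ x : Fin N → ℝ, 0 ≤ x i0 → u x ≤ C)
    (hu_pde : ∀ x : Fin N → ℝ, 0 < x i0 → lap u x + f (u x) = 0)
    (hu_init : ∀ x : Fin N → ℝ, x i0 = 0 → u x = u₀ x)
    (hu₀_cont : ContinuousOn u₀ {x : Fin N → ℝ | x i0 = 0})
    (hu₀_bdd : ∃ C, ∀ x : Fin N → ℝ, x i0 = 0 → u₀ x ≤ C)
    (hu₀_nonneg : ∀ x : Fin N → ℝ, x i0 = 0 → 0 ≤ u₀ x)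
    (hu₀_ne : ∃ x : Fin N → ℝ, x i0 = 0 ∧ u₀ x ≠ 0) :
    ∃ z : ℝ, μ ≤ z ∧ f z = 0 ∧
      ∀ A : ℝ,
        C2ConvOn i0 u {x : Fin N → ℝ | A ≤ x i0}
          (fun _ => z) (fun _ _ => 0) (fun _ _ _ => 0) := by
  obtain ⟨hlip, hμ'0, hμ'μ, hfpos, hfneg, -, hf0⟩ := id hf
  have : NeZero N := ⟨by omega⟩
  have hμ0 : 0 < μ := hμ'0.trans hμ'μ
  have hopen : IsOpen {x : Fin N → ℝ | 0 < x i0} :=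
    isOpen_lt continuous_const (continuous_apply i0)
  have hs : ∀ x, 0 < x i0 → ContDiffAt ℝ 2 u x := fun x hx =>
    hu_smooth.contDiffAt (hopen.mem_nhds hx)
  have hpde : ∀ x, 0 < x i0 → HasLap u x (-f (u x)) := fun x hx => by
    rw [← eq_neg_of_add_eq_zero_left (hu_pde x hx)]
    exact hasLap_lap (hs x hx)
  obtain ⟨C₀, hC₀⟩ := hu_bdd
  set C := max C₀ μ with hC
  have hb : ∀ x, 0 < x i0 → u x ∈ Icc 0 C := fun x hx =>
    ⟨hu_nonneg x hx.le, (hC₀ x hx.le).trans (le_max_left _ _)⟩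
  have hfnn : ∀ s, 0 ≤ s → s < μ → 0 ≤ f s := fun s hs0 hsμ => by
    rcases hs0.eq_or_lt with h | h
    · rw [← h]
      rcases hf0 with h0 | ⟨h0, -⟩
      · exact h0.le
      · exact h0.ge
    · exact (hfpos s h hsμ).le
  have hex : ∃ p : Fin N → ℝ, 0 < p i0 ∧ 0 < u p := by
    obtain ⟨x, hx, hux⟩ := hu₀_ne
    have hux' : 0 < u x := by
      rw [hu_init x hx]
      exact lt_of_le_of_ne (hu₀_nonneg x hx) (Ne.symm hux)
    have hupd : Function.update x i0 (0 : ℝ) = x := by rw [← hx, Function.update_eq_self]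
    have hline : ContinuousWithinAt (fun t => u (Function.update x i0 t)) (Ici 0) 0 := by
      refine ContinuousWithinAt.comp (g := u) (t := {x : Fin N → ℝ | 0 ≤ x i0}) ?_
        (continuous_update_right x i0).continuousWithinAt fun t ht => ?_
      · rw [hupd]
        exact hu_cont x hx.ge
      · simpa using ht
    have hev : ∀ᶠ t in nhdsWithin (0 : ℝ) (Ici 0), 0 < u (Function.update x i0 t) := by
      refine hline.eventually_const_lt ?_
      show 0 < u (Function.update x i0 0)
      rwa [hupd]
    have hev' := hev.filter_mono (nhdsWithin_mono 0 Ioi_subset_Ici_self)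
    obtain ⟨t, ht, ht0⟩ := (hev'.and self_mem_nhdsWithin).exists
    exact ⟨Function.update x i0 t, by simpa using ht0, ht⟩
  have hpos := pos_of_exists_pos hμ0 hfnn hs hpde (fun x hx => (hb x hx).1) hex
  have hlower : ∀ δ, 0 < δ → δ < μ → ∃ R, ∀ x : Fin N → ℝ, R < x i0 → δ ≤ u x :=
    fun δ hδ hδμ => by
      obtain ⟨c, hc, hcf⟩ := hf.exists_linear_lower_bound hδ hδμ
      exact eventually_ge_of_linear_lower_bound hc hδ hcf hs hpde hpos
  obtain ⟨M, hM1, hM2⟩ := exists_limsup hb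
  have hμM : μ ≤ M := by
    refine le_of_forall_pos_lt_add fun ε hε => ?_
    set δ := max (μ - ε / 2) (μ / 2) with hδ
    obtain ⟨R, hR⟩ := hlower δ ((by positivity : 0 < μ / 2).trans_le (le_max_right _ _))
      (max_lt (by linarith) (by linarith))
    obtain ⟨R', -, hR'⟩ := hM1 (ε / 2) (by positivity)
    set x : Fin N → ℝ := fun _ => max R R' + 1
    have h1 := hR x (by linarith [le_max_left R R'] : R < max R R' + 1)
    have h2 := hR' x (by linarith [le_max_right R R'] : R' < max R R' + 1)
    linarith [le_max_left (μ - ε / 2) (μ / 2)]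
  have hMC : M ∈ Icc 0 C := by
    refine ⟨hμ0.le.trans hμM, ?_⟩
    refine le_of_forall_pos_lt_add fun ε hε => ?_
    obtain ⟨x, hx, hux⟩ := hM2 ε hε 0
    linarith [(hb x hx).2]
  have hfM : f M = 0 := le_antisymm (hfneg M hμM)
    (nonneg_of_limsup hMC (hlip.continuousOn C) hs hpde hb hM1 hM2)
  obtain ⟨ℓ, hℓ⟩ := hlip C
  refine ⟨M, hμM, hfM, fun A =>
    c2ConvOn_of_uniform (NeZero.pos N) hfM hMC hℓ hs hpde hb ?_ A⟩
  rcases hμM.eq_or_lt with heq | hlt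
  · intro ε hε
    set δ := max (μ - ε) (μ / 2) with hδ
    obtain ⟨R, hR⟩ := hlower δ ((by positivity : 0 < μ / 2).trans_le (le_max_right _ _))
      (max_lt (by linarith) (by linarith))
    obtain ⟨R', -, hR'⟩ := hM1 ε hε
    refine ⟨max R R', fun x hx => ?_⟩
    obtain ⟨h1, h2⟩ := max_lt_iff.1 hx
    rw [abs_le]
    constructor
    · linarith [hR x h1, le_max_left (μ - ε) (μ / 2)]
    · linarith [hR' x h2]
  · obtain ⟨c, hc, hev⟩ := hf3 M hlt hfM
    obtain ⟨m, hm, hIoo⟩ := mem_nhdsLT_iff_exists_Ioo_subset.1 hev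
    have hm : m < M := hm
    obtain ⟨B, hB⟩ := isCompact_Icc.exists_bound_of_continuousOn (hlip.continuousOn C)
    refine uniform_of_limsup (δ := M - m) hlt hc (by linarith) hfneg (fun s hs1 hs2 => ?_)
      ⟨B, hB⟩ hs hpde hb hM1 hM2
    have h1 : c ≤ f s / (s - M) := hIoo ⟨by linarith, hs2⟩
    rwa [le_div_iff_of_neg (by linarith)] at h1
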